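/- The assignment sending a sequence (J_n, w_n)_{n ≥ 0} ∈ T(J, δ) to the element w_m⁻¹ for m sufficiently large (this is well defined since the w_n stabilize) is a bijection from T(J, δ) onto W^J. -/

import Mathlib

namespace HePaper

variable {I : Type*} {M : CoxeterMatrix I} {W : Type*} [Group W]

/-- The standard parabolic subgroup `W_J` generated by the simple reflections `s_j`, `j ∈ J`. -/
def parabolic (cs : CoxeterSystem M W) (J : Set I) : Subgroup W :=
  Subgroup.closure (cs.simple '' J)

/-- `W^J`, the set of minimal length coset representatives for `W/W_J`. -/
def minRight (cs : CoxeterSystem M W) (J : Set I) : Set W :=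
  {w : W | ∀ j ∈ J, cs.length w < cs.length (w * cs.simple j)}

/-- `^J W`, the set of minimal length coset representatives for `W_J\W`. -/
def minLeft (cs : CoxeterSystem M W) (J : Set I) : Set W :=
  {w : W | ∀ j ∈ J, cs.length w < cs.length (cs.simple j * w)}

/-- `Ad(u)(K) = {k ∈ I : s_k = u s_j u⁻¹ for some j ∈ K}`. -/
def AdSet (cs : CoxeterSystem M W) (u : W) (K : Set I) : Set I :=
  {k : I | ∃ j ∈ K, cs.simple k = u * cs.simple j * u⁻¹}

/-- Membership in the set `T(J, δ)` of sequences `(J_n, w_n)_{n ≥ 0}`. -/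
def InT (cs : CoxeterSystem M W) (J : Set I) (δ : I ≃ I)
    (Jseq : ℕ → Set I) (wseq : ℕ → W) : Prop :=
  Jseq 0 = J ∧
  (∀ n : ℕ, Jseq (n + 1) = Jseq n ∩ AdSet cs (wseq n) (δ '' Jseq n)) ∧
  (∀ n : ℕ, wseq n ∈ minLeft cs (Jseq n) ∩ minRight cs (δ '' Jseq n)) ∧
  (∀ n : ℕ, ∃ x ∈ parabolic cs (Jseq (n + 1)), ∃ y ∈ parabolic cs (δ '' Jseq n),
      wseq (n + 1) = x * wseq n * y)

/-- `I(J, δ; w)`: the largest subset `K ⊆ J` with `Ad(w)(K) = δ(K)`. -/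
def IJdw (cs : CoxeterSystem M W) (J : Set I) (δ : I ≃ I) (w : W) : Set I :=
  ⋃₀ {K : Set I | K ⊆ J ∧ AdSet cs w K = δ '' K}

/-- The orbit of `w` under the `W_J`-action `x · y = δ(x) y x⁻¹`. -/
def orbit (cs : CoxeterSystem M W) (J : Set I) (δW : W ≃* W) (w : W) : Set W :=
  {y : W | ∃ x ∈ parabolic cs J, y = δW x * w * x⁻¹}

/-- The set of elements of minimal length in the orbit of `w`. -/
def orbitMin (cs : CoxeterSystem M W) (J : Set I) (δW : W ≃* W) (w : W) : Set W :=
  {v ∈ orbit cs J δW w | ∀ u ∈ orbit cs J δW w, cs.length v ≤ cs.length u}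

/-- `w →_{s_j} w'` for some `j ∈ J`: `w' = s_{δ(j)} w s_j` and `ℓ(w') ≤ ℓ(w)`. -/
def stepTo (cs : CoxeterSystem M W) (J : Set I) (δ : I ≃ I) (w w' : W) : Prop :=
  ∃ j ∈ J, w' = cs.simple (δ j) * w * cs.simple j ∧ cs.length w' ≤ cs.length w

/-- `w →_{J,δ} w'`. -/
def toRel (cs : CoxeterSystem M W) (J : Set I) (δ : I ≃ I) : W → W → Prop :=
  Relation.ReflTransGen (stepTo cs J δ)

/-- `w` and `w'` are elementarily strongly `(J, δ)`-conjugate. -/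
def ElemStrong (cs : CoxeterSystem M W) (J : Set I) (δW : W ≃* W) (w w' : W) : Prop :=
  cs.length w = cs.length w' ∧
  ∃ x ∈ parabolic cs J, w' = δW x * w * x⁻¹ ∧
    (cs.length (δW x * w) = cs.length x + cs.length w ∨
     cs.length (w * x⁻¹) = cs.length x + cs.length w)

/-- `w ∼_{J,δ} w'`: strongly `(J, δ)`-conjugate. -/
def simRel (cs : CoxeterSystem M W) (J : Set I) (δW : W ≃* W) : W → W → Prop :=
  Relation.ReflTransGen (ElemStrong cs J δW)

/-- The Bruhat order on `W`: some reduced word for `w` contains a subword that is a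
reduced word for `u`. -/
def bruhatLE (cs : CoxeterSystem M W) (u w : W) : Prop :=
  ∃ ω : List I, cs.wordProd ω = w ∧ cs.IsReduced ω ∧
    ∃ ω' : List I, ω'.Sublist ω ∧ cs.wordProd ω' = u ∧ cs.IsReduced ω'

/-- `supp(w)`: the smallest subset `K ⊆ I` with `w ∈ W_K`. -/
def supp (cs : CoxeterSystem M W) (w : W) : Set I :=
  ⋂₀ {K : Set I | w ∈ parabolic cs K}

/-- `supp_δ(w)`: the smallest `δ`-stable subset of `I` containing `supp(w)`. -/
def suppDelta (cs : CoxeterSystem M W) (δ : I ≃ I) (w : W) : Set I :=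
  ⋃ n : ℕ, (⇑δ)^[n] '' supp cs w

/-- `w ≤_{J,δ} w'` for `w, w' ∈ W^J`. -/
def leJd (cs : CoxeterSystem M W) (J : Set I) (δW : W ≃* W) (w w' : W) : Prop :=
  ∀ v' ∈ orbitMin cs J δW w', ∃ v ∈ orbitMin cs J δW w, bruhatLE cs v v'


section StrongExchange

open CoxeterSystem List

open Classical in
/-- The signed conjugation by a simple reflection: it conjugates the first coordinate and flips
the sign exactly at the simple reflection itself. -/
noncomputable def signedConj (cs : CoxeterSystem M W) (i : I) : Equiv.Perm (W × ZMod 2) where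
  toFun p := (cs.simple i * p.1 * cs.simple i, p.2 + if p.1 = cs.simple i then 1 else 0)
  invFun p := (cs.simple i * p.1 * cs.simple i, p.2 + if p.1 = cs.simple i then 1 else 0)
  left_inv := by
    rintro ⟨t, e⟩
    have h : cs.simple i * t * cs.simple i = cs.simple i ↔ t = cs.simple i := by
      rw [mul_eq_right, mul_eq_one_iff_eq_inv', cs.inv_simple]
    ext
    · simp [mul_assoc]
    · simp only [h, add_assoc, CharTwo.add_self_eq_zero, add_zero]
  right_inv := by
    rintro ⟨t, e⟩
    have h : cs.simple i * t * cs.simple i = cs.simple i ↔ t = cs.simple i := by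
      rw [mul_eq_right, mul_eq_one_iff_eq_inv', cs.inv_simple]
    ext
    · simp [mul_assoc]
    · simp only [h, add_assoc, CharTwo.add_self_eq_zero, add_zero]

open Classical in
theorem prod_signedConj_apply (cs : CoxeterSystem M W) (ω : List I) (p : W × ZMod 2) :
    (ω.map (signedConj cs)).prod p =
      (cs.wordProd ω * p.1 * (cs.wordProd ω)⁻¹, p.2 + ((cs.rightInvSeq ω).count p.1 : ℕ)) := by
  induction ω with
  | nil => simp
  | cons i ω ih =>
    rw [map_cons, prod_cons, Equiv.Perm.mul_apply, ih]
    have h : cs.wordProd ω * p.1 * (cs.wordProd ω)⁻¹ = cs.simple i ↔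
        (cs.wordProd ω)⁻¹ * cs.simple i * cs.wordProd ω = p.1 := by
      constructor <;> rintro h <;> rw [← h] <;> group
    ext
    · simp [signedConj, wordProd_cons, mul_assoc]
    · simp only [signedConj, Equiv.coe_fn_mk, h, rightInvSeq, count_cons, beq_iff_eq]
      push_cast
      ring

theorem prod_map_alternatingWord {G : Type*} [Monoid G] (f : I → G) (i j : I) (m : ℕ) :
    ((alternatingWord i j (2 * m)).map f).prod = (f i * f j) ^ m := by
  induction m with
  | zero => simp [alternatingWord]
  | succ m ih =>
    rw [show 2 * (m + 1) = 2 * m + 1 + 1 by ring, alternatingWord_succ', alternatingWord_succ']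
    simp [ih, pow_succ', mul_assoc]

theorem reverse_alternatingWord (i j : I) (m : ℕ) :
    (alternatingWord i j (2 * m)).reverse = alternatingWord j i (2 * m) := by
  induction m with
  | zero => simp [alternatingWord]
  | succ m ih =>
    rw [show 2 * (m + 1) = 2 * m + 1 + 1 by ring, alternatingWord_succ', alternatingWord_succ',
      alternatingWord_succ, alternatingWord_succ]
    simp [ih]

open Classical in
theorem even_count_rightInvSeq_alternatingWord (cs : CoxeterSystem M W) (i j : I) (t : W) :
    Even ((cs.rightInvSeq (alternatingWord i j (2 * M i j))).count t) := by
  rw [← reverse_alternatingWord j i, rightInvSeq_reverse, count_reverse]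
  set L := cs.leftInvSeq (alternatingWord j i (2 * M i j)) with hL
  have hlen : L.length = 2 * M i j := by simp [hL]
  have hhalf : L.take (M i j) = L.drop (M i j) := by
    apply List.ext_getElem
    · simp [hlen]; lia
    · intro k h₁ h₂
      have hk : k < M i j := by simp at h₁; lia
      rw [getElem_take, getElem_drop,
        cs.getElem_leftInvSeq_alternatingWord j i (M i j) k (by lia),
        cs.getElem_leftInvSeq_alternatingWord j i (M i j) (M i j + k) (by lia),
        prod_alternatingWord_eq_mul_pow, prod_alternatingWord_eq_mul_pow]
      have h1 : (2 * k + 1) / 2 = k := by lia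
      have h2 : (2 * (M i j + k) + 1) / 2 = M i j + k := by lia
      simp [h1, h2, pow_add]
  rw [← take_append_drop (M i j) L, count_append, hhalf]
  exact ⟨_, rfl⟩

theorem isLiftable_signedConj (cs : CoxeterSystem M W) : M.IsLiftable (signedConj cs) := by
  classical
  intro i j
  rw [← prod_map_alternatingWord]
  ext1 p
  rw [prod_signedConj_apply]
  have h : cs.wordProd (alternatingWord i j (2 * M i j)) = 1 := by
    rw [wordProd, prod_map_alternatingWord, simple_mul_simple_pow]
  rw [h, (ZMod.natCast_eq_zero_iff_even).2 (even_count_rightInvSeq_alternatingWord cs i j p.1)]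
  simp

open Classical in
/-- The parity of the multiplicity of `t` in the right inversion sequence of a word depends only
on the element represented by the word. -/
theorem count_rightInvSeq_congr (cs : CoxeterSystem M W) {ω ω' : List I}
    (h : cs.wordProd ω = cs.wordProd ω') (t : W) :
    ((cs.rightInvSeq ω).count t : ZMod 2) = (cs.rightInvSeq ω').count t := by
  have key (ω : List I) : cs.lift ⟨_, isLiftable_signedConj cs⟩ (cs.wordProd ω) =
      (ω.map (signedConj cs)).prod := by
    rw [wordProd, map_list_prod, map_map]
    congr 2
    ext1 i
    simp
  have := congrArg (fun g : Equiv.Perm (W × ZMod 2) ↦ (g (t, 0)).2)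
    ((key ω).symm.trans ((congrArg _ h).trans (key ω')))
  simpa [prod_signedConj_apply] using this

theorem simple_mem_rightInvSeq (cs : CoxeterSystem M W) {ω : List I} {i : I}
    (h : cs.length (cs.wordProd ω * cs.simple i) < cs.length (cs.wordProd ω)) :
    cs.simple i ∈ cs.rightInvSeq ω := by
  classical
  obtain ⟨τ, hτ, hτω⟩ := cs.exists_isReduced (cs.wordProd ω * cs.simple i)
  have hω : cs.wordProd ω = cs.wordProd (τ ++ [i]) := by
    rw [wordProd_append, ← hτω]; simp
  have hnot : cs.simple i ∉ cs.rightInvSeq τ := by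
    intro hmem
    have := (cs.isRightInversion_of_mem_rightInvSeq hτ hmem).2
    rw [← hτω] at this
    simp at this
    lia
  by_contra hmem
  have := count_rightInvSeq_congr cs hω (cs.simple i)
  rw [← concat_eq_append, rightInvSeq_concat, concat_eq_append, count_append,
    count_eq_zero_of_not_mem hmem] at this
  have hz : (map (MulAut.conj (cs.simple i)) (cs.rightInvSeq τ)).count (cs.simple i) = 0 := by
    refine count_eq_zero_of_not_mem fun h ↦ hnot ?_
    obtain ⟨x, hx, hxi⟩ := mem_map.1 h
    rw [MulAut.conj_apply, cs.inv_simple, mul_eq_right, mul_eq_one_iff_eq_inv',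
      cs.inv_simple] at hxi
    exact hxi ▸ hx
  simp [hz] at this

/-- The exchange condition, for left multiplication. -/
theorem exists_simple_mul_eq_eraseIdx (cs : CoxeterSystem M W) {ω : List I} {i : I}
    (h : cs.length (cs.simple i * cs.wordProd ω) < cs.length (cs.wordProd ω)) :
    ∃ k < ω.length, cs.simple i * cs.wordProd ω = cs.wordProd (ω.eraseIdx k) := by
  have h' : cs.length (cs.wordProd ω.reverse * cs.simple i) <
      cs.length (cs.wordProd ω.reverse) := by
    rw [wordProd_reverse, length_inv, ← length_inv]; simpa using h
  have hmem := simple_mem_rightInvSeq cs h'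
  rw [rightInvSeq_reverse, mem_reverse] at hmem
  obtain ⟨k, hk, hki⟩ := mem_iff_getElem.1 hmem
  refine ⟨k, by simpa using hk, ?_⟩
  rw [← getD_leftInvSeq_mul_wordProd, getD_eq_getElem _ _ hk, hki]

/-- The deletion condition: every word has a reduced subword with the same product. -/
theorem exists_isReduced_sublist (cs : CoxeterSystem M W) (ω : List I) :
    ∃ ω', ω'.Sublist ω ∧ cs.IsReduced ω' ∧ cs.wordProd ω' = cs.wordProd ω := by
  induction ω with
  | nil => exact ⟨[], .slnil, by simp [CoxeterSystem.IsReduced], rfl⟩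
  | cons i ω ih =>
    obtain ⟨τ, hτω, hτ, hprod⟩ := ih
    rcases cs.length_simple_mul (cs.wordProd τ) i with h | h
    · refine ⟨i :: τ, hτω.cons_cons i, ?_, by rw [wordProd_cons, wordProd_cons, hprod]⟩
      rw [CoxeterSystem.IsReduced, wordProd_cons, h, hτ.eq, length_cons]
    · obtain ⟨k, hk, hki⟩ := exists_simple_mul_eq_eraseIdx cs (i := i) (ω := τ) (by lia)
      refine ⟨τ.eraseIdx k, ((eraseIdx_sublist τ k).trans hτω).cons i, ?_, ?_⟩
      · rw [CoxeterSystem.IsReduced, ← hki, length_eraseIdx_of_lt hk, ← hτ.eq]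
        lia
      · rw [← hki, hprod, wordProd_cons]

end StrongExchange

section Parabolic

open CoxeterSystem

variable (cs : CoxeterSystem M W) {J K : Set I}

theorem parabolic_mono (h : J ⊆ K) : parabolic cs J ≤ parabolic cs K :=
  Subgroup.closure_mono (Set.image_mono h)

theorem simple_mem_parabolic {j : I} (h : j ∈ J) : cs.simple j ∈ parabolic cs J :=
  Subgroup.subset_closure ⟨j, h, rfl⟩

theorem wordProd_mem_parabolic {ω : List I} (h : ∀ i ∈ ω, i ∈ J) :
    cs.wordProd ω ∈ parabolic cs J := by
  refine Subgroup.list_prod_mem _ fun x hx ↦ ?_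
  obtain ⟨i, hi, rfl⟩ := List.mem_map.1 hx
  exact simple_mem_parabolic cs (h i hi)

theorem exists_isReduced_of_mem_parabolic {y : W} (hy : y ∈ parabolic cs J) :
    ∃ ω : List I, (∀ i ∈ ω, i ∈ J) ∧ cs.IsReduced ω ∧ cs.wordProd ω = y := by
  have : ∃ ω : List I, (∀ i ∈ ω, i ∈ J) ∧ cs.wordProd ω = y := by
    induction hy using Subgroup.closure_induction with
    | mem x hx =>
      obtain ⟨j, hj, rfl⟩ := hx
      exact ⟨[j], by simpa, by simp⟩
    | one => exact ⟨[], by simp, by simp⟩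
    | mul x y _ _ hx hy =>
      obtain ⟨ω, hω, rfl⟩ := hx
      obtain ⟨τ, hτ, rfl⟩ := hy
      exact ⟨ω ++ τ, by simpa [or_imp, forall_and] using ⟨hω, hτ⟩, wordProd_append ..⟩
    | inv x _ hx =>
      obtain ⟨ω, hω, rfl⟩ := hx
      exact ⟨ω.reverse, by simpa using hω, wordProd_reverse ..⟩
  obtain ⟨ω, hω, rfl⟩ := this
  obtain ⟨τ, hτω, hτ, hprod⟩ := exists_isReduced_sublist cs ω
  exact ⟨τ, fun i hi ↦ hω i (hτω.subset hi), hτ, hprod⟩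

/-- Every coset of a parabolic subgroup contains an element `v` with `ℓ(v y) = ℓ(v) + ℓ(y)` for
all `y` in the subgroup. -/
theorem exists_length_mul_eq_add (K : Set I) (w : W) :
    ∃ v, v⁻¹ * w ∈ parabolic cs K ∧
      ∀ y ∈ parabolic cs K, cs.length (v * y) = cs.length v + cs.length y := by
  obtain ⟨v, hv, hmin⟩ := exists_minimalFor_of_wellFoundedLT
    (fun v ↦ v⁻¹ * w ∈ parabolic cs K) cs.length ⟨w, by simp [one_mem]⟩
  refine ⟨v, hv, fun y hy ↦ (cs.length_mul_le v y).antisymm ?_⟩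
  obtain ⟨ω, hω, hvω⟩ := cs.exists_isReduced v
  obtain ⟨τ, hτK, hτ, rfl⟩ := exists_isReduced_of_mem_parabolic cs hy
  obtain ⟨ρ, hsub, hρ, hprod⟩ := exists_isReduced_sublist cs (ω ++ τ)
  obtain ⟨ω', τ', rfl, hω', hτ'⟩ := List.sublist_append_iff.1 hsub
  rw [wordProd_append, wordProd_append, ← hvω] at hprod
  have hmem := wordProd_mem_parabolic cs fun i hi ↦ hτK i (hτ'.subset hi)
  have hlen : cs.length v ≤ cs.length (cs.wordProd ω') := by
    refine le_of_not_gt fun hlt ↦ hlt.not_ge (hmin ?_ hlt.le)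
    have : (cs.wordProd ω')⁻¹ * w =
        cs.wordProd τ' * (cs.wordProd τ)⁻¹ * (v⁻¹ * w) := by
      rw [eq_mul_inv_of_mul_eq hprod]
      group
    simp only [this]
    exact mul_mem (mul_mem hmem (inv_mem hy)) hv
  have hω'ω : ω' = ω := hω'.eq_of_length_le <| by
    rw [← hω.eq, ← hvω]
    exact hlen.trans (cs.length_wordProd_le ω')
  rw [hω'ω, ← hvω] at hprod
  have hρlen := hρ.eq
  rw [hω'ω, wordProd_append, ← hvω, hprod, List.length_append, ← hω.eq, ← hvω] at hρlen
  rw [hρlen, ← mul_left_cancel hprod]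
  exact Nat.add_le_add_left (cs.length_wordProd_le τ') _

theorem eq_one_of_mem_parabolic {y : W} (hy : y ∈ parabolic cs K)
    (h : ∀ j ∈ K, cs.length y < cs.length (y * cs.simple j)) : y = 1 := by
  obtain ⟨ω, hωK, hω, rfl⟩ := exists_isReduced_of_mem_parabolic cs hy
  rcases ω.eq_nil_or_concat with rfl | ⟨τ, j, rfl⟩
  · simp
  · have hj := h j (hωK j (by simp))
    rw [hω.eq, wordProd_concat, simple_mul_simple_cancel_right] at hj
    have := cs.length_wordProd_le τ
    simp at hj
    lia

theorem length_mul_of_mem_minRight {v y : W} (hv : v ∈ minRight cs K)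
    (hy : y ∈ parabolic cs K) : cs.length (v * y) = cs.length v + cs.length y := by
  obtain ⟨u, hu, hlen⟩ := exists_length_mul_eq_add cs K v
  have huv : u⁻¹ * v = 1 := by
    refine eq_one_of_mem_parabolic cs hu fun j hj ↦ ?_
    have h1 := hlen _ hu
    have h2 := hlen _ (mul_mem hu (simple_mem_parabolic cs hj))
    have h3 := hv j hj
    rw [mul_inv_cancel_left] at h1
    rw [← mul_assoc, mul_inv_cancel_left] at h2
    lia
  rw [inv_mul_eq_one] at huv
  exact huv ▸ hlen y hy

theorem exists_mem_minRight (K : Set I) (w : W) :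
    ∃ v ∈ minRight cs K, v⁻¹ * w ∈ parabolic cs K := by
  obtain ⟨v, hv, hlen⟩ := exists_length_mul_eq_add cs K w
  refine ⟨v, fun j hj ↦ ?_, hv⟩
  rw [hlen _ (simple_mem_parabolic cs hj), length_simple]
  lia

theorem eq_of_mem_minRight {u v : W} (hu : u ∈ minRight cs K) (hv : v ∈ minRight cs K)
    (h : u⁻¹ * v ∈ parabolic cs K) : u = v := by
  rw [← inv_mul_eq_one]
  refine eq_one_of_mem_parabolic cs h fun j hj ↦ ?_
  have h1 := length_mul_of_mem_minRight cs hu h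
  have h2 := length_mul_of_mem_minRight cs hu (mul_mem h (simple_mem_parabolic cs hj))
  have h3 := hv j hj
  rw [mul_inv_cancel_left] at h1
  rw [← mul_assoc, mul_inv_cancel_left] at h2
  lia

theorem mem_minLeft_of_mul_mem_minLeft {v y : W} (hv : v ∈ minRight cs K)
    (hy : y ∈ parabolic cs K) (h : v * y ∈ minLeft cs J) : v ∈ minLeft cs J := by
  intro j hj
  have h1 := h j hj
  have h2 := length_mul_of_mem_minRight cs hv hy
  have h3 := cs.length_mul_le (cs.simple j * v) y
  rcases cs.length_simple_mul v j with h4 | h4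
  · lia
  · rw [mul_assoc] at h3
    lia

/-- If `w ∈ ^J W^K`, then any simple reflection `s_j`, `j ∈ J`, in `w W_K w⁻¹` is conjugate under
`w` to a simple reflection in `K`. -/
theorem mem_adSet_of_conj {w y : W} {j : I} (hj : cs.length w < cs.length (cs.simple j * w))
    (hw : w ∈ minRight cs K) (hy : y ∈ parabolic cs K) (h : cs.simple j * w = w * y) :
    j ∈ AdSet cs w K := by
  have h1 := length_mul_of_mem_minRight cs hw hy
  have hy1 : cs.length y = 1 := by
    rw [← h] at h1
    rcases cs.length_simple_mul w j with h2 | h2 <;> lia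
  obtain ⟨ω, hωK, hω, rfl⟩ := exists_isReduced_of_mem_parabolic cs hy
  obtain ⟨k, rfl⟩ := List.length_eq_one_iff.1 (hω.eq.symm.trans hy1)
  refine ⟨k, hωK k (by simp), ?_⟩
  rw [eq_mul_inv_iff_mul_eq, h, wordProd_singleton]

/-- If `w ∈ ^J W^K` and `y ∈ W_K`, a left descent in `J` of `w y` is conjugate under `w` to a simple
reflection in `K`. -/
theorem mem_adSet_of_length_lt {w y : W} {j : I}
    (hj : cs.length w < cs.length (cs.simple j * w)) (hw : w ∈ minRight cs K)
    (hy : y ∈ parabolic cs K) (h : cs.length (cs.simple j * (w * y)) < cs.length (w * y)) :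
    j ∈ AdSet cs w K := by
  obtain ⟨ω, hω, hwω⟩ := cs.exists_isReduced w
  obtain ⟨τ, hτK, hτ, rfl⟩ := exists_isReduced_of_mem_parabolic cs hy
  nth_rw 1 2 [hwω] at h
  rw [← wordProd_append] at h
  obtain ⟨k, -, hki⟩ := exists_simple_mul_eq_eraseIdx cs h
  rw [wordProd_append, ← hwω] at hki
  rcases lt_or_ge k ω.length with hk | hk
  · rw [List.eraseIdx_append_of_lt_length hk, wordProd_append, ← mul_assoc] at hki
    have hlt := cs.length_wordProd_le (ω.eraseIdx k)
    rw [← mul_right_cancel hki, List.length_eraseIdx_of_lt hk, ← hω.eq, ← hwω] at hlt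
    lia
  · rw [List.eraseIdx_append_of_length_le hk, wordProd_append, ← hwω] at hki
    refine mem_adSet_of_conj cs hj hw (y := cs.wordProd (τ.eraseIdx (k - ω.length)) *
      (cs.wordProd τ)⁻¹) (mul_mem (wordProd_mem_parabolic cs fun i hi ↦
        hτK i ((List.eraseIdx_sublist _ _).subset hi)) (inv_mem hy)) ?_
    rw [← mul_assoc, ← hki]
    group

end Parabolic

section Bedard

variable (cs : CoxeterSystem M W) {J K : Set I}

theorem inv_mem_minRight_iff {w : W} : w⁻¹ ∈ minRight cs J ↔ w ∈ minLeft cs J := by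
  refine forall₂_congr fun j _ ↦ ?_
  rw [cs.length_inv, ← cs.length_inv (w⁻¹ * cs.simple j), mul_inv_rev, inv_inv, cs.inv_simple]

theorem conj_mem_parabolic {x w : W} (hJ : J ⊆ AdSet cs w K) (hx : x ∈ parabolic cs J) :
    w⁻¹ * x * w ∈ parabolic cs K := by
  have : parabolic cs J ≤ (parabolic cs K).comap (MulAut.conj w⁻¹).toMonoidHom := by
    refine (Subgroup.closure_le _).2 ?_
    rintro _ ⟨j, hj, rfl⟩
    obtain ⟨k, hk, hjk⟩ := hJ hj
    simpa [hjk, mul_assoc] using simple_mem_parabolic cs hk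
  simpa using this hx

variable {cs} {δ : I ≃ I} {Jseq : ℕ → Set I} {wseq : ℕ → W}

namespace InT

theorem antitone (h : InT cs J δ Jseq wseq) : Antitone Jseq :=
  antitone_nat_of_succ_le fun n ↦ (h.2.1 n).trans_subset Set.inter_subset_left

theorem inv_mul_succ_mem (h : InT cs J δ Jseq wseq) (n : ℕ) :
    (wseq n)⁻¹ * wseq (n + 1) ∈ parabolic cs (δ '' Jseq n) := by
  obtain ⟨x, hx, y, hy, hxy⟩ := h.2.2.2 n
  have := conj_mem_parabolic cs ((h.2.1 n).trans_subset Set.inter_subset_right) hx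
  rw [hxy, ← mul_assoc, ← mul_assoc]
  exact mul_mem this hy

theorem inv_mul_mem (h : InT cs J δ Jseq wseq) {n m : ℕ} (hnm : n ≤ m) :
    (wseq n)⁻¹ * wseq m ∈ parabolic cs (δ '' Jseq n) := by
  induction m, hnm using Nat.le_induction with
  | base => simp [one_mem]
  | succ m hnm ih =>
    have := parabolic_mono cs (Set.image_mono (h.antitone hnm)) (h.inv_mul_succ_mem m)
    simpa [mul_assoc] using mul_mem ih this

theorem eventually_const [Finite I] (h : InT cs J δ Jseq wseq) :
    ∃ N, ∀ n, N ≤ n → wseq n = wseq N := by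
  obtain ⟨N, hN⟩ := WellFoundedLT.antitone_chain_condition h.antitone
  refine ⟨N, fun n hn ↦ (eq_of_mem_minRight cs (h.2.2.1 N).2 ?_ (h.inv_mul_mem hn)).symm⟩
  exact hN n hn ▸ (h.2.2.1 n).2

theorem mem_minLeft_and_mem_of_mem_adSet (h : InT cs J δ Jseq wseq) (n : ℕ) :
    wseq n ∈ minLeft cs J ∧ ∀ j ∈ J, j ∈ AdSet cs (wseq n) (δ '' Jseq n) → j ∈ Jseq n := by
  induction n with
  | zero => exact ⟨h.1 ▸ (h.2.2.1 0).1, fun j hj _ ↦ h.1 ▸ hj⟩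
  | succ n ih =>
    have hmem := h.inv_mul_succ_mem n
    have hsucc {j : I} (hj : j ∈ J) (hAd : j ∈ AdSet cs (wseq n) (δ '' Jseq n)) :
        j ∈ Jseq (n + 1) := by
      rw [h.2.1 n]
      exact ⟨ih.2 j hj hAd, hAd⟩
    constructor
    · intro j hj
      refine lt_of_not_ge fun hle ↦ ?_
      have hlt := lt_of_le_of_ne hle (cs.length_simple_mul_ne _ _)
      refine hlt.not_gt ((h.2.2.1 (n + 1)).1 j (hsucc hj ?_))
      refine mem_adSet_of_length_lt cs (ih.1 j hj) (h.2.2.1 n).2 hmem ?_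
      rwa [mul_inv_cancel_left]
    · rintro j hj ⟨k, hk, hjk⟩
      have hk' := simple_mem_parabolic cs (Set.image_mono (h.antitone n.le_succ) hk)
      refine hsucc hj (mem_adSet_of_conj cs (ih.1 j hj) (h.2.2.1 n).2
        (mul_mem (mul_mem hmem hk') (inv_mem hmem)) ?_)
      rw [hjk]
      group

theorem eq_of_eventually_eq {Jseq' : ℕ → Set I} {wseq' : ℕ → W}
    (h : InT cs J δ Jseq wseq) (h' : InT cs J δ Jseq' wseq') {N : ℕ}
    (hN : ∀ n, N ≤ n → wseq n = wseq' n) (n : ℕ) :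
    Jseq n = Jseq' n ∧ wseq n = wseq' n := by
  have key (n : ℕ) (hJ : Jseq n = Jseq' n) : wseq n = wseq' n := by
    refine eq_of_mem_minRight cs (h.2.2.1 n).2 (hJ ▸ (h'.2.2.1 n).2) ?_
    have h1 := h.inv_mul_mem (le_max_left n N)
    have h2 := h'.inv_mul_mem (le_max_left n N)
    rw [← hJ, ← hN _ (le_max_right n N)] at h2
    simpa [mul_assoc] using mul_mem h1 (inv_mem h2)
  induction n with
  | zero =>
    have hJ : Jseq 0 = Jseq' 0 := h.1.trans h'.1.symm
    exact ⟨hJ, key 0 hJ⟩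
  | succ n ih =>
    have hJ : Jseq (n + 1) = Jseq' (n + 1) := by rw [h.2.1, h'.2.1, ih.1, ih.2]
    exact ⟨hJ, key _ hJ⟩

end InT

/-- If `K ⊆ Ad(w)(δ(K))` then conjugation by `w` maps the simple reflections in `δ(K)` onto those
in `K`. -/
theorem exists_simple_eq_conj [Finite W] (hδM : ∀ i j : I, M (δ i) (δ j) = M i j) {w : W}
    (hK : K ⊆ AdSet cs w (δ '' K)) {k : I} (hk : k ∈ δ '' K) :
    ∃ j ∈ K, cs.simple j = w * cs.simple k * w⁻¹ := by
  have hδ : M.IsLiftable (cs.simple ∘ δ) := fun i j ↦ by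
    rw [← hδM i j]
    exact cs.simple_mul_simple_pow _ _
  have hcard : (cs.simple '' (δ '' K)).ncard ≤ (cs.simple '' K).ncard := by
    have : cs.simple '' (δ '' K) = cs.lift ⟨_, hδ⟩ '' (cs.simple '' K) := by
      simp [Set.image_image]
    rw [this]
    exact Set.ncard_image_le
  have hsub : MulAut.conj w⁻¹ '' (cs.simple '' K) ⊆ cs.simple '' (δ '' K) := by
    rintro _ ⟨_, ⟨j, hj, rfl⟩, rfl⟩
    obtain ⟨k, hk, hjk⟩ := hK hj
    exact ⟨k, hk, by simp [hjk, mul_assoc]⟩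
  have heq := Set.eq_of_subset_of_ncard_le hsub
    (hcard.trans_eq (Set.ncard_image_of_injective _ (MulAut.conj w⁻¹).injective).symm)
  obtain ⟨_, ⟨j, hj, rfl⟩, hjk⟩ := heq.ge ⟨k, hk, rfl⟩
  exact ⟨j, hj, by simp [← hjk, mul_assoc]⟩

theorem exists_inT_of_mem_minLeft [Finite I] [Finite W]
    (hδM : ∀ i j : I, M (δ i) (δ j) = M i j) {w : W} (hw : w ∈ minLeft cs J) :
    ∃ Jseq wseq, InT cs J δ Jseq wseq ∧ ∃ N, ∀ n, N ≤ n → wseq n = w := by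
  choose v hv hvw using fun K : Set I ↦ exists_mem_minRight cs (δ '' K) w
  let Jseq : ℕ → Set I := fun n ↦ (fun K ↦ K ∩ AdSet cs (v K) (δ '' K))^[n] J
  have hsucc (n : ℕ) : Jseq (n + 1) = Jseq n ∩ AdSet cs (v (Jseq n)) (δ '' Jseq n) :=
    Function.iterate_succ_apply' ..
  have hanti : Antitone Jseq :=
    antitone_nat_of_succ_le fun n ↦ (hsucc n).trans_subset Set.inter_subset_left
  have hleft (K : Set I) : v K ∈ minLeft cs J :=
    mem_minLeft_of_mul_mem_minLeft cs (hv K) (hvw K) (by rwa [mul_inv_cancel_left])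
  refine ⟨Jseq, fun n ↦ v (Jseq n), ⟨rfl, hsucc, fun n ↦ ⟨?_, hv _⟩, fun n ↦ ?_⟩, ?_⟩
  · exact fun j hj ↦ hleft _ j (hanti n.zero_le hj)
  · refine ⟨1, one_mem _, (v (Jseq n))⁻¹ * v (Jseq (n + 1)), ?_, by simp⟩
    have := parabolic_mono cs (Set.image_mono (hanti n.le_succ)) (hvw (Jseq (n + 1)))
    simpa [mul_assoc] using mul_mem (hvw (Jseq n)) (inv_mem this)
  · obtain ⟨N, hN⟩ := WellFoundedLT.antitone_chain_condition hanti
    refine ⟨N, fun n hn ↦ ?_⟩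
    dsimp only
    rw [← hN n hn]
    have hK : Jseq N ⊆ AdSet cs (v (Jseq N)) (δ '' Jseq N) :=
      (hN _ N.le_succ).trans_subset ((hsucc N).trans_subset Set.inter_subset_right)
    set u := v (Jseq N) with hu
    have huw : u⁻¹ * w ∈ parabolic cs (δ '' Jseq N) := hvw _
    have huR : u ∈ minRight cs (δ '' Jseq N) := hv _
    rw [← inv_mul_eq_one, ← inv_eq_one]
    refine eq_one_of_mem_parabolic cs (inv_mem huw) fun k hk ↦ ?_
    obtain ⟨j, hj, hjk⟩ := exists_simple_eq_conj hδM hK hk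
    have h1 := length_mul_of_mem_minRight cs huR huw
    have h2 := length_mul_of_mem_minRight cs huR (mul_mem (simple_mem_parabolic cs hk) huw)
    have h3 := hw j (hanti N.zero_le hj)
    rw [mul_inv_cancel_left] at h1
    have h4 : u * (cs.simple k * (u⁻¹ * w)) = cs.simple j * w := by
      rw [hjk]
      group
    rw [cs.length_inv, ← cs.length_inv ((u⁻¹ * w)⁻¹ * cs.simple k), mul_inv_rev, inv_inv,
      cs.inv_simple]
    rw [h4] at h2
    lia

end Bedard

/-- the assignment `(J_n, w_n)_{n ≥ 0} ↦ w_m⁻¹` (for `m` sufficiently large)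
is a bijection from `T(J, δ)` onto `W^J`. -/
theorem bedard_bijection
    [Fintype I] [Finite W]
    (cs : CoxeterSystem M W) (J : Set I) (δ : I ≃ I)
    (hδM : ∀ i j : I, M (δ i) (δ j) = M i j) :
    ∃ f : (ℕ → Set I) × (ℕ → W) → W,
      (∀ p : (ℕ → Set I) × (ℕ → W), InT cs J δ p.1 p.2 →
        ∃ N : ℕ, ∀ n : ℕ, N ≤ n → f p = (p.2 n)⁻¹) ∧
      Set.BijOn f {p : (ℕ → Set I) × (ℕ → W) | InT cs J δ p.1 p.2} (minRight cs J) := by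
  have hlim (p : (ℕ → Set I) × (ℕ → W)) : ∃ x : W, InT cs J δ p.1 p.2 →
      ∃ N : ℕ, ∀ n : ℕ, N ≤ n → x = (p.2 n)⁻¹ := by
    by_cases hp : InT cs J δ p.1 p.2
    · obtain ⟨N, hN⟩ := hp.eventually_const
      exact ⟨(p.2 N)⁻¹, fun _ ↦ ⟨N, fun n hn ↦ by rw [hN n hn]⟩⟩
    · exact ⟨1, fun h ↦ absurd h hp⟩
  choose f hf using hlim
  refine ⟨f, hf, fun p hp ↦ ?_, fun p hp q hq hpq ↦ ?_, fun x hx ↦ ?_⟩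
  · obtain ⟨N, hN⟩ := hf p hp
    rw [hN N le_rfl, inv_mem_minRight_iff]
    exact (InT.mem_minLeft_and_mem_of_mem_adSet hp N).1
  · obtain ⟨N, hN⟩ := hf p hp
    obtain ⟨N', hN'⟩ := hf q hq
    have key := InT.eq_of_eventually_eq hp hq (N := max N N') fun n hn ↦ by
      rw [← inv_inj, ← hN n (le_of_max_le_left hn), ← hN' n (le_of_max_le_right hn), hpq]
    exact Prod.ext (funext fun n ↦ (key n).1) (funext fun n ↦ (key n).2)
  · rw [← inv_inv x, inv_mem_minRight_iff] at hx
    obtain ⟨Jseq, wseq, h, N, hN⟩ := exists_inT_of_mem_minLeft hδM hx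
    obtain ⟨N', hN'⟩ := hf (Jseq, wseq) h
    refine ⟨(Jseq, wseq), h, ?_⟩
    rw [hN' _ (le_max_right N N')]
    simp [hN _ (le_max_left N N')]

end HePaper
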